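/- Let α ∈ [0, π/2), let A ∈ M_n(ℂ) be a sector matrix of angle α with 0 < m·I_n ≤ Re A ≤ M·I_n for some 0 < m ≤ M, and set h = M/m. Then for every normalized positive linear map Φ : M_n(ℂ) → M_l(ℂ), the operator (spectral) norm satisfies ‖Φ((Re A)^{-1})·(Φ(Re(A^{-1})))^{-1} + (Φ(Re(A^{-1})))^{-1}·Φ((Re A)^{-1})‖ ≤ 2·sec²(α)·K(h)^{1/2}. -/

import Mathlib

open Matrix
open scoped ComplexOrder

/-- The real (Hermitian) part of a complex matrix: `Re A = (A + Aᴴ)/2`. -/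
noncomputable def matRe {n : ℕ} (A : Matrix (Fin n) (Fin n) ℂ) : Matrix (Fin n) (Fin n) ℂ :=
  (2⁻¹ : ℂ) • (A + Aᴴ)

/-- `A` is a sector matrix of angle `α`: its numerical range is contained in
`S_α = {z : Re z > 0, |Im z| ≤ tan α · Re z}`. -/
def InSector {n : ℕ} (α : ℝ) (A : Matrix (Fin n) (Fin n) ℂ) : Prop :=
  ∀ x : Fin n → ℂ, star x ⬝ᵥ x = 1 →
    0 < (star x ⬝ᵥ A *ᵥ x).re ∧
      |(star x ⬝ᵥ A *ᵥ x).im| ≤ Real.tan α * (star x ⬝ᵥ A *ᵥ x).re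

/-- The Kantorovich constant `K(x) = (x+1)²/(4x)`. -/
noncomputable def kant (x : ℝ) : ℝ := (x + 1) ^ 2 / (4 * x)

open scoped MatrixOrder Matrix.Norms.L2Operator in
theorem comm_psd {n : ℕ} {A B : Matrix (Fin n) (Fin n) ℂ} (hA : A.PosSemidef) (hB : B.PosSemidef)
    (h : Commute A B) : (A * B).PosSemidef := by
  rw [← Matrix.nonneg_iff_posSemidef] at *
  exact h.mul_nonneg hA hB

open scoped MatrixOrder in
theorem psd_antisymm {n : ℕ} {A : Matrix (Fin n) (Fin n) ℂ} (hA : A.PosSemidef)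
    (hB : (-A).PosSemidef) : A = 0 := by
  apply le_antisymm
  · rw [Matrix.le_iff, zero_sub]; exact hB
  · rw [Matrix.nonneg_iff_posSemidef]; exact hA

theorem schur_psd {n : ℕ} {H T : Matrix (Fin n) (Fin n) ℂ} {t : ℝ} (ht : 0 ≤ t) (hH : H.PosDef)
    (h1 : (t • H - T).PosSemidef) (h2 : (t • H + T).PosSemidef) :
    ((t ^ 2) • H - T * H⁻¹ * T).PosSemidef := by
  have hGH : H⁻¹ * H = 1 := nonsing_inv_mul _ ((isUnit_iff_isUnit_det _).1 hH.isUnit)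
  have hHG : H * H⁻¹ = 1 := mul_nonsing_inv _ ((isUnit_iff_isUnit_det _).1 hH.isUnit)
  rcases ht.eq_or_lt with rfl | ht
  · have : T = 0 := psd_antisymm (by simpa using h2) (by simpa using h1)
    simpa [this] using Matrix.PosSemidef.zero
  · have hG := hH.inv.posSemidef.isHermitian
    have e1 := h2.mul_mul_conjTranspose_same ((t • H - T) * H⁻¹)
    have e2 := h1.mul_mul_conjTranspose_same ((t • H + T) * H⁻¹)
    rw [conjTranspose_mul, hG.eq, h1.1.eq] at e1
    rw [conjTranspose_mul, hG.eq, h2.1.eq] at e2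
    have e := (e1.add e2).smul (show 0 ≤ (2 * t)⁻¹ by positivity)
    convert e using 1
    generalize H⁻¹ = G at *
    have a1 : (t • H - T) * G * (t • H + T) = t ^ 2 • H - T * G * T := by
      simp only [sub_mul, mul_add, smul_mul_assoc, hHG, one_mul, mul_smul_comm, mul_assoc, hGH,
        mul_one]
      module
    have a2 : (t • H + T) * G * (t • H - T) = t ^ 2 • H - T * G * T := by
      simp only [add_mul, mul_sub, smul_mul_assoc, hHG, one_mul, mul_smul_comm, mul_assoc, hGH,
        mul_one]
      module
    rw [a1, a2, ← mul_add, ← mul_add]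
    have a3 : t • H - T + (t • H + T) = (2 * t) • H := by module
    rw [a3, mul_smul_comm, mul_smul_comm, smul_smul, hGH, inv_mul_cancel₀ (by positivity), one_smul,
      mul_one]

noncomputable def matIm {n : ℕ} (A : Matrix (Fin n) (Fin n) ℂ) : Matrix (Fin n) (Fin n) ℂ :=
  (-Complex.I * 2⁻¹ : ℂ) • (A - Aᴴ)

theorem matRe_herm {n : ℕ} (A : Matrix (Fin n) (Fin n) ℂ) : (matRe A).IsHermitian := by
  simp [matRe, IsHermitian, conjTranspose_smul, add_comm]

theorem matIm_herm {n : ℕ} (A : Matrix (Fin n) (Fin n) ℂ) : (matIm A).IsHermitian := by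
  simp only [matIm, IsHermitian, conjTranspose_smul, conjTranspose_sub, conjTranspose_conjTranspose]
  rw [← neg_sub A, smul_neg, ← neg_smul]
  simp

theorem A_eq {n : ℕ} (A : Matrix (Fin n) (Fin n) ℂ) : A = matRe A + Complex.I • matIm A := by
  simp only [matRe, matIm, smul_smul]
  rw [show Complex.I * (-Complex.I * 2⁻¹) = 2⁻¹ by
    rw [← mul_assoc, mul_neg, Complex.I_mul_I]; simp]
  module

theorem AH_eq {n : ℕ} (A : Matrix (Fin n) (Fin n) ℂ) : Aᴴ = matRe A - Complex.I • matIm A := by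
  conv_lhs => rw [A_eq A]
  simp [conjTranspose_smul, (matRe_herm A).eq, (matIm_herm A).eq, sub_eq_add_neg]

theorem herm_im {n : ℕ} {A : Matrix (Fin n) (Fin n) ℂ} (h : A.IsHermitian) (x : Fin n → ℂ) :
    (star x ⬝ᵥ A *ᵥ x).im = 0 := h.im_star_dotProduct_mulVec_self x

theorem form_re {n : ℕ} (A : Matrix (Fin n) (Fin n) ℂ) (x : Fin n → ℂ) :
    (star x ⬝ᵥ A *ᵥ x).re = (star x ⬝ᵥ matRe A *ᵥ x).re := by
  conv_lhs => rw [A_eq A]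
  simp [add_mulVec, smul_mulVec, herm_im (matIm_herm A)]

theorem form_im {n : ℕ} (A : Matrix (Fin n) (Fin n) ℂ) (x : Fin n → ℂ) :
    (star x ⬝ᵥ A *ᵥ x).im = (star x ⬝ᵥ matIm A *ᵥ x).re := by
  conv_lhs => rw [A_eq A]
  simp [add_mulVec, smul_mulVec, herm_im (matRe_herm A)]

theorem psd_of_unit {n : ℕ} {A : Matrix (Fin n) (Fin n) ℂ} (h : A.IsHermitian)
    (hu : ∀ x : Fin n → ℂ, star x ⬝ᵥ x = 1 → 0 ≤ (star x ⬝ᵥ A *ᵥ x).re) : A.PosSemidef := by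
  refine .of_dotProduct_mulVec_nonneg h fun x => ?_
  rw [Complex.nonneg_iff]
  refine ⟨?_, (herm_im h x).symm⟩
  by_cases hx : x = 0
  · simp [hx]
  have hp : 0 < star x ⬝ᵥ x := by simpa using hx
  obtain ⟨r, hr⟩ : ∃ r : ℝ, star x ⬝ᵥ x = r := ⟨(star x ⬝ᵥ x).re, by
    apply Complex.ext; · simp
    simpa using (Complex.pos_iff.1 hp).2.symm⟩
  rw [hr] at hp
  have hr0 : 0 < r := by simpa using hp
  have hs : Real.sqrt r ^ 2 = r := Real.sq_sqrt hr0.le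
  have hs0 : 0 < Real.sqrt r := Real.sqrt_pos.2 hr0
  have := hu ((((Real.sqrt r)⁻¹ : ℝ) : ℂ) • x) (by
    simp only [star_smul, smul_dotProduct, dotProduct_smul, hr, smul_eq_mul]
    simp only [RCLike.star_def, Complex.conj_ofReal]
    rw [← Complex.ofReal_mul, ← Complex.ofReal_mul]
    norm_cast
    field_simp
    exact hs.symm)
  simp only [star_smul, smul_dotProduct, dotProduct_smul, mulVec_smul, smul_eq_mul,
    RCLike.star_def, Complex.conj_ofReal, Complex.re_ofReal_mul] at this
  have hi : 0 < (Real.sqrt r)⁻¹ := by positivity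
  exact nonneg_of_mul_nonneg_right (nonneg_of_mul_nonneg_right this hi) hi

theorem re_inv_le {n : ℕ} {α : ℝ} (hα : α ∈ Set.Ico 0 (Real.pi / 2))
    {A : Matrix (Fin n) (Fin n) ℂ} (hA : InSector α A) (hH : (matRe A).PosDef) :
    ((Real.cos α)⁻¹ ^ 2 • matRe A⁻¹ - (matRe A)⁻¹).PosSemidef ∧ (matRe A⁻¹).PosSemidef := by
  have hu : IsUnit A := by
    rw [← mulVec_injective_iff_isUnit]
    change Function.Injective A.mulVecLin
    rw [injective_iff_map_eq_zero' (A.mulVecLin)]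
    intro x
    refine ⟨fun h => ?_, fun h => by simp [h]⟩
    by_contra hx
    have h1 := hH.re_dotProduct_pos hx
    have h2 := form_re A x
    simp only [mulVecLin_apply] at h
    rw [h] at h2
    simp at h2 h1
    linarith
  have hud := (isUnit_iff_isUnit_det _).1 hu
  have hAA : A⁻¹ * A = 1 := nonsing_inv_mul _ hud
  have hAA' : Aᴴ * A⁻¹ᴴ = 1 := by rw [← conjTranspose_mul, hAA, conjTranspose_one]
  have hud' := (isUnit_iff_isUnit_det _).1 hH.isUnit
  have hGH : (matRe A)⁻¹ * matRe A = 1 := nonsing_inv_mul _ hud'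
  have hHG : matRe A * (matRe A)⁻¹ = 1 := mul_nonsing_inv _ hud'
  have hc : 0 < Real.cos α := Real.cos_pos_of_mem_Ioo ⟨by linarith [hα.1, Real.pi_pos], hα.2⟩
  have ht : 0 ≤ Real.tan α := Real.tan_nonneg_of_nonneg_of_le_pi_div_two hα.1 hα.2.le
  have hsec : (Real.cos α)⁻¹ ^ 2 = 1 + Real.tan α ^ 2 := by
    rw [Real.tan_eq_sin_div_cos]; field_simp; linarith [Real.sin_sq_add_cos_sq α]
  have k1 : Aᴴ * matRe A⁻¹ * A = matRe A := by
    simp only [matRe, mul_smul_comm, smul_mul_assoc, mul_add, add_mul, hAA', mul_assoc, hAA]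
    simp [add_comm]
  have k2 : Aᴴ * (matRe A)⁻¹ * A = matRe A + matIm A * (matRe A)⁻¹ * matIm A := by
    conv_lhs => rw [AH_eq]
    have : ∀ X Y : Matrix (Fin n) (Fin n) ℂ, X * A = Y ↔ X * (matRe A + Complex.I • matIm A) = Y := by
      intro X Y; rw [← A_eq]
    rw [this]
    simp only [sub_mul, mul_add, smul_mul_assoc, hHG, one_mul, mul_smul_comm, mul_assoc, hGH,
        mul_one, smul_smul, smul_sub, Complex.I_mul_I]
    module
  constructor
  · rw [← IsUnit.posSemidef_star_left_conjugate_iff hu, star_eq_conjTranspose, mul_sub, sub_mul,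
      mul_smul_comm, smul_mul_assoc, k1, k2, hsec]
    have := schur_psd (T := matIm A) ht hH
      (psd_of_unit (((matRe_herm A).smul (.all _)).sub (matIm_herm A)) fun x hx => by
        have := (abs_le.1 (hA x hx).2).2
        rw [form_re, form_im] at this
        simpa [-Complex.ofReal_tan, sub_mulVec, smul_mulVec] using this)
      (psd_of_unit (((matRe_herm A).smul (.all _)).add (matIm_herm A)) fun x hx => by
        have := (abs_le.1 (hA x hx).2).1
        rw [form_re, form_im] at this
        simp [-Complex.ofReal_tan, add_mulVec, smul_mulVec]
        linarith)
    convert this using 1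
    module
  · rw [← IsUnit.posSemidef_star_left_conjugate_iff hu, star_eq_conjTranspose, k1]
    exact hH.posSemidef

theorem psd_inner {n : ℕ} {A : Matrix (Fin n) (Fin n) ℂ} (h : A.PosSemidef)
    (v : EuclideanSpace ℂ (Fin n)) : 0 ≤ (inner ℂ v (toEuclideanCLM (𝕜 := ℂ) A v)).re := by
  have := h.re_dotProduct_nonneg v.ofLp
  rw [EuclideanSpace.inner_eq_star_dotProduct, ofLp_toEuclideanCLM, dotProduct_comm]
  exact this

theorem norm_core {l : ℕ} {P Q : Matrix (Fin l) (Fin l) ℂ} {a b : ℝ} (ha : 0 < a) (hab : a ≤ b)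
    (h1 : (P - a • 1).PosSemidef) (h2 : (b • (1 : Matrix (Fin l) (Fin l) ℂ) - P).PosSemidef)
    (hPQ : (Q - P).PosSemidef) (v : EuclideanSpace ℂ (Fin l)) :
    ‖toEuclideanCLM (𝕜 := ℂ) P v‖ ≤
      (a + b) / (2 * Real.sqrt (a * b)) * ‖toEuclideanCLM (𝕜 := ℂ) Q v‖ := by
  have hP : P.IsHermitian := by
    have := h1.1.add ((isHermitian_one (n := Fin l) (α := ℂ)).smul (.all a : IsSelfAdjoint a))
    simpa using this
  have hc := comm_psd h1 h2 (by
    refine Commute.sub_left (Commute.sub_right ?_ (.refl _)) (Commute.sub_right ?_ ?_)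
    · exact (Commute.one_right P).smul_right b
    · exact ((Commute.one_left _).smul_left a)
    · exact ((Commute.one_left _).smul_left a))
  have e : (P - a • 1) * (b • (1 : Matrix (Fin l) (Fin l) ℂ) - P)
      = (a + b) • P - (a * b) • 1 - Pᴴ * P := by
    rw [hP.eq]
    simp only [sub_mul, mul_sub, smul_mul_assoc, mul_smul_comm, mul_one, one_mul]
    module
  rw [e] at hc
  have i1 := psd_inner hc v
  have i2 := psd_inner hPQ v
  have real_smul : ∀ (r : ℝ) (X : Matrix (Fin l) (Fin l) ℂ), r • X = (r : ℂ) • X := fun r X => by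
    ext; simp
  rw [real_smul, real_smul] at i1
  simp only [map_sub, map_smul, map_mul, map_one, ContinuousLinearMap.sub_apply, inner_sub_right,
    ContinuousLinearMap.smul_apply, inner_smul_right, ContinuousLinearMap.one_apply,
    ContinuousLinearMap.mul_apply, ← star_eq_conjTranspose, map_star,
    ContinuousLinearMap.star_eq_adjoint, ContinuousLinearMap.adjoint_inner_right, Complex.sub_re,
    Complex.re_ofReal_mul, inner_self_eq_norm_sq_to_K] at i1 i2
  have i3 : (inner ℂ v (toEuclideanCLM (𝕜 := ℂ) Q v)).re ≤ ‖v‖ * ‖toEuclideanCLM (𝕜 := ℂ) Q v‖ :=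
    re_inner_le_norm (𝕜 := ℂ) _ _
  norm_cast at i1
  simp only [Complex.coe_algebraMap, ← Complex.ofReal_pow, Complex.ofReal_re] at i1
  set p := ‖toEuclideanCLM (𝕜 := ℂ) P v‖
  set q := ‖toEuclideanCLM (𝕜 := ℂ) Q v‖
  have hb : 0 < b := by linarith
  have hs : 0 < Real.sqrt (a * b) := by positivity
  have hs2 : Real.sqrt (a * b) ^ 2 = a * b := Real.sq_sqrt (by positivity)
  have hq : 0 ≤ q := norm_nonneg _
  rw [div_mul_eq_mul_div, le_div_iff₀ (by positivity)]
  refine (abs_le_of_sq_le_sq' ?_ (by positivity)).2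
  have i4 : p ^ 2 ≤ (a + b) * (‖v‖ * q) - a * b * ‖v‖ ^ 2 := by
    have := mul_le_mul_of_nonneg_left (i3.trans' (sub_nonneg.1 i2)) (show 0 ≤ a + b by positivity)
    linarith
  have i5 := mul_le_mul_of_nonneg_left i4 (show 0 ≤ 4 * (a * b) by positivity)
  rw [mul_pow, mul_pow, hs2]
  nlinarith [sq_nonneg ((a + b) * q - 2 * (a * b) * ‖v‖)]

/-- For a sector matrix `A` of angle `α ∈ [0, π/2)` with `0 < m·I ≤ Re A ≤ M·I`, `h = M/m`,
and every normalized positive linear map `Φ`, the operator norm satisfies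
`‖Φ((Re A)⁻¹)Φ(Re(A⁻¹))⁻¹ + Φ(Re(A⁻¹))⁻¹Φ((Re A)⁻¹)‖ ≤ 2 sec²(α) K(h)^{1/2}`. -/
theorem stmt14 {n l : ℕ} {α : ℝ} (hα : α ∈ Set.Ico 0 (Real.pi / 2))
    {A : Matrix (Fin n) (Fin n) ℂ} (hA : InSector α A)
    {m M : ℝ} (hm : 0 < m) (hmM : m ≤ M)
    (h1 : (matRe A - m • 1).PosSemidef)
    (h2 : (M • (1 : Matrix (Fin n) (Fin n) ℂ) - matRe A).PosSemidef)
    (Φ : Matrix (Fin n) (Fin n) ℂ →ₗ[ℂ] Matrix (Fin l) (Fin l) ℂ)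
    (hΦpos : ∀ X : Matrix (Fin n) (Fin n) ℂ, X.PosSemidef → (Φ X).PosSemidef)
    (hΦ1 : Φ 1 = 1) :
    ‖Matrix.toEuclideanCLM (𝕜 := ℂ)
        (Φ ((matRe A)⁻¹) * (Φ (matRe A⁻¹))⁻¹ + (Φ (matRe A⁻¹))⁻¹ * Φ ((matRe A)⁻¹))‖ ≤
      2 * (Real.cos α)⁻¹ ^ 2 * Real.sqrt (kant (M / m)) := by
  have hM : 0 < M := by linarith
  have hH : (matRe A).PosDef := by
    have := PosDef.posSemidef_add h1 (PosDef.one.smul hm)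
    simpa using this
  have hud' := (isUnit_iff_isUnit_det _).1 hH.isUnit
  have hGH : (matRe A)⁻¹ * matRe A = 1 := nonsing_inv_mul _ hud'
  have hHG : matRe A * (matRe A)⁻¹ = 1 := mul_nonsing_inv _ hud'
  obtain ⟨hle, hB⟩ := re_inv_le hα hA hH
  have hcm : Commute (matRe A)⁻¹ (matRe A) := by rw [Commute, SemiconjBy, hGH, hHG]
  have hsm : ∀ (r : ℝ) (X : Matrix (Fin n) (Fin n) ℂ), Φ (r • X) = r • Φ X := fun r X =>
    Φ.map_smul_of_tower r X
  have g1 : ((matRe A)⁻¹ - M⁻¹ • 1).PosSemidef := by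
    have := (comm_psd hH.inv.posSemidef h2
      (Commute.sub_right ((Commute.one_right _).smul_right _) hcm)).smul (inv_pos.2 hM).le
    rw [mul_sub, mul_smul_comm, hGH, mul_one, smul_sub, smul_smul, inv_mul_cancel₀ hM.ne',
      one_smul] at this
    exact this
  have g2 : (m⁻¹ • (1 : Matrix (Fin n) (Fin n) ℂ) - (matRe A)⁻¹).PosSemidef := by
    have := (comm_psd hH.inv.posSemidef h1
      (Commute.sub_right hcm ((Commute.one_right _).smul_right _))).smul (inv_pos.2 hm).le
    rw [mul_sub, mul_smul_comm, hGH, mul_one, smul_sub, smul_smul, inv_mul_cancel₀ hm.ne',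
      one_smul] at this
    exact this
  replace g1 := hΦpos _ g1
  replace g2 := hΦpos _ g2
  replace hle := hΦpos _ hle
  replace hB := hΦpos _ hB
  rw [map_sub, hsm, hΦ1] at g1 g2
  rw [map_sub, hsm] at hle
  generalize Φ (matRe A)⁻¹ = X at *
  generalize Φ (matRe A⁻¹) = Y at *
  set s := (Real.cos α)⁻¹ ^ 2
  have hc : 0 < Real.cos α := Real.cos_pos_of_mem_Ioo ⟨by linarith [hα.1, Real.pi_pos], hα.2⟩
  have hs : 0 < s := by positivity
  have hX : X.IsHermitian := by
    have := g1.1.add ((isHermitian_one (n := Fin l) (α := ℂ)).smul (.all M⁻¹ : IsSelfAdjoint M⁻¹))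
    simpa using this
  have hY : Y.PosDef := by
    have := (PosDef.posSemidef_add (hle.add g1) (PosDef.one.smul (inv_pos.2 hM))).smul (inv_pos.2 hs)
    simpa [smul_smul, hs.ne'] using this
  have hYY : Y * Y⁻¹ = 1 := mul_nonsing_inv _ ((isUnit_iff_isUnit_det _).1 hY.isUnit)
  have hk : (M⁻¹ + m⁻¹) / (2 * Real.sqrt (M⁻¹ * m⁻¹)) = Real.sqrt (kant (M / m)) := by
    symm
    rw [Real.sqrt_eq_iff_mul_self_eq_of_pos (by positivity)]
    have hs2 : Real.sqrt (M⁻¹ * m⁻¹) ^ 2 = M⁻¹ * m⁻¹ := Real.sq_sqrt (by positivity)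
    rw [← sq, div_pow, mul_pow, hs2, kant]
    field_simp
    ring
  have key : ‖toEuclideanCLM (𝕜 := ℂ) (X * Y⁻¹)‖ ≤ s * Real.sqrt (kant (M / m)) := by
    refine ContinuousLinearMap.opNorm_le_bound _ (by positivity) fun z => ?_
    have := norm_core (inv_pos.2 hM) (inv_anti₀ hm hmM) g1 g2 hle
      (toEuclideanCLM (𝕜 := ℂ) Y⁻¹ z)
    rw [← ContinuousLinearMap.mul_apply, ← map_mul, ← ContinuousLinearMap.mul_apply, ← map_mul, hk,
      smul_mul_assoc, hYY] at this
    have e : toEuclideanCLM (𝕜 := ℂ) (s • (1 : Matrix (Fin l) (Fin l) ℂ)) z = s • z := by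
      rw [show s • (1 : Matrix (Fin l) (Fin l) ℂ) = (s : ℂ) • 1 by ext; simp, map_smul, map_one]
      ext; simp
    rw [e, norm_smul, Real.norm_of_nonneg hs.le] at this
    linarith
  have key2 : ‖toEuclideanCLM (𝕜 := ℂ) (Y⁻¹ * X)‖ ≤ s * Real.sqrt (kant (M / m)) := by
    have : Y⁻¹ * X = star (X * Y⁻¹) := by
      rw [star_eq_conjTranspose, conjTranspose_mul, hX.eq, hY.inv.1.eq]
    rw [this, map_star, ContinuousLinearMap.star_eq_adjoint,
      LinearIsometryEquiv.norm_map]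
    exact key
  rw [map_add]
  refine (norm_add_le _ _).trans ?_
  linarith
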